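/- The Stasheff polytope contains the permutohedron: for every permutation σ of {1,…,n}, the point M(σ) = (σ(1),…,σ(n)) lies in the convex hull of the point set {M(t) : t ∈ Y_n} ⊂ ℝ^n. Consequently the convex hull of {M(σ) : σ ∈ S_n} is contained in the convex hull of {M(t) : t ∈ Y_n}. -/

import Mathlib

/-- Planar binary trees: a tree is either a single leaf, or the grafting
`node l r = l ∨ r` of two planar binary trees. `Y n` is the set of such trees with
`n + 1` leaves. -/
inductive PBT : Type
  | leaf : PBT
  | node : PBT → PBT → PBT
  deriving DecidableEq

namespace PBT

/-- Number of leaves of a planar binary tree. A tree of `Y n` has `n + 1` leaves. -/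
def leaves : PBT → ℕ
  | leaf => 1
  | node l r => l.leaves + r.leaves

/-- The list of coordinates of Loday's point `M(t)`: `M(|)` is the empty tuple and
`M(t^l ∨ t^r) = (M(t^l), p·q, M(t^r))` where `p`, `q` are the numbers of leaves of
`t^l`, `t^r`.  The `i`-th entry is the weight `a_i · b_i` of the `i`-th internal
vertex of `t`.  A tree `t` belongs to `Y n` iff `t.coords.length = n`. -/
noncomputable def coords : PBT → List ℝ
  | leaf => []
  | node l r => l.coords ++ ((l.leaves : ℝ) * (r.leaves : ℝ)) :: r.coords

/-- The point `M(t) = (a_1 b_1, …, a_n b_n) ∈ ℝ^n`, for `t ∈ Y n`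
(coordinates indexed by `Fin n`, the `i`-th coordinate being `x_{i+1}`). -/
noncomputable def M (n : ℕ) (t : PBT) : Fin n → ℝ := fun i => t.coords.getD i 0

end PBT

/-- The permutohedron vertex `M(σ) = (σ(1), …, σ(n))`
(0-indexed: the `i`-th coordinate is `σ(i) + 1`). -/
noncomputable def Mperm (n : ℕ) (σ : Equiv.Perm (Fin n)) : Fin n → ℝ :=
  fun i => ((σ i : ℕ) : ℝ) + 1

open Finset in
/-- A sum over an interval of length `p + 1 + q`, split at its `p`-th element. -/
theorem sum_range_add_one_add (F : ℕ → ℝ) (p q : ℕ) :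
    ∑ i ∈ range (p + 1 + q), F i =
      ∑ i ∈ range p, F i + F p + ∑ i ∈ range q, F (p + 1 + i) := by
  rw [sum_range_add, sum_range_succ]

namespace PBT

theorem leaves_eq_length_coords_add_one (t : PBT) : t.leaves = t.coords.length + 1 := by
  induction t with
  | leaf => rfl
  | node l r hl hr =>
    simp only [leaves, coords, List.length_append, List.length_cons, hl, hr]
    omega

theorem length_coords_node (l r : PBT) :
    (node l r).coords.length = l.coords.length + 1 + r.coords.length := by
  simp only [coords, List.length_append, List.length_cons]
  omega

theorem sum_coords (t : PBT) :
    t.coords.sum = (t.coords.length : ℝ) * (t.coords.length + 1) / 2 := by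
  induction t with
  | leaf => simp [coords]
  | node l r hl hr =>
    rw [length_coords_node]
    simp only [coords, List.sum_append, List.sum_cons, hl, hr, leaves_eq_length_coords_add_one]
    push_cast
    ring

theorem getD_coords_node_left (l r : PBT) {i : ℕ} (hi : i < l.coords.length) :
    (node l r).coords.getD i 0 = l.coords.getD i 0 :=
  List.getD_append _ _ _ _ hi

theorem getD_coords_node_root (l r : PBT) :
    (node l r).coords.getD l.coords.length 0 = (l.leaves : ℝ) * r.leaves := by
  rw [coords, List.getD_append_right _ _ _ _ le_rfl]
  simp

theorem getD_coords_node_right (l r : PBT) (i : ℕ) :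
    (node l r).coords.getD (l.coords.length + 1 + i) 0 = r.coords.getD i 0 := by
  rw [coords, List.getD_append_right _ _ _ _ (by omega),
    show l.coords.length + 1 + i - l.coords.length = i + 1 by omega, List.getD_cons_succ]

theorem sum_range_getD_coords (t : PBT) :
    ∑ i ∈ Finset.range t.coords.length, t.coords.getD i 0 =
      (t.coords.length : ℝ) * (t.coords.length + 1) / 2 := by
  rw [← sum_coords, Finset.sum_range, ← Fin.sum_univ_getElem]
  simp

theorem finite_setOf_length_coords_lt (n : ℕ) : {t : PBT | t.coords.length < n}.Finite := by
  induction n with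
  | zero => simp
  | succ n ih =>
    refine ((ih.image2 node ih).insert leaf).subset ?_
    rintro (_ | ⟨l, r⟩) ht
    · exact Set.mem_insert _ _
    · rw [Set.mem_ofPred_eq, length_coords_node] at ht
      exact Set.mem_insert_of_mem _ ⟨l, by simp only [Set.mem_ofPred_eq]; omega,
        r, by simp only [Set.mem_ofPred_eq]; omega, rfl⟩

/-- Given weights `c` and a point `x` satisfying the inequalities of the associahedron, rooting
each interval at the smallest weight gives a tree whose point has the smallest weighted sum. -/
theorem exists_sum_sub_mul_sub_nonneg (n : ℕ) (c x : ℕ → ℝ)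
    (hx : ∀ a k, a + k ≤ n → (k : ℝ) * (k + 1) / 2 ≤ ∑ i ∈ Finset.range k, x (a + i)) :
    ∃ t : PBT, t.coords.length = n ∧ ∀ m, (∀ i < n, m ≤ c i) →
      0 ≤ ∑ i ∈ Finset.range n, (c i - m) * (x i - t.coords.getD i 0) := by
  induction n using Nat.strong_induction_on generalizing c x with
  | _ n ih =>
  obtain rfl | hn := Nat.eq_zero_or_pos n
  · exact ⟨leaf, rfl, by simp⟩
  obtain ⟨p, hp, hmin⟩ := Finset.exists_min_image (Finset.range n) c ⟨0, by simpa using hn⟩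
  rw [Finset.mem_range] at hp
  simp only [Finset.mem_range] at hmin
  obtain ⟨q, rfl⟩ := Nat.exists_eq_add_of_lt hp
  rw [show p + q + 1 = p + 1 + q by omega] at *
  obtain ⟨l, hl, hl'⟩ := ih p (by omega) c x fun a k h => hx a k (by omega)
  obtain ⟨r, hr, hr'⟩ := ih q (by omega) (fun i => c (p + 1 + i)) (fun i => x (p + 1 + i))
    fun a k h => by simpa only [add_assoc] using hx (p + 1 + a) k (by omega)
  have hlen : (node l r).coords.length = p + 1 + q := by rw [length_coords_node, hl, hr]
  refine ⟨node l r, hlen, fun m hm => ?_⟩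
  have hleft := hl' (c p) fun i hi => hmin i (by omega)
  have hright := hr' (c p) fun i hi => hmin (p + 1 + i) (by omega)
  have hroot : 0 ≤ (c p - m) *
      ∑ i ∈ Finset.range (p + 1 + q), (x i - (node l r).coords.getD i 0) := by
    refine mul_nonneg (sub_nonneg.2 (hm p hp)) ?_
    have hM := sum_range_getD_coords (node l r)
    have h := hx 0 (p + 1 + q) (by omega)
    rw [hlen] at hM
    simp only [zero_add] at h
    rw [Finset.sum_sub_distrib, hM]
    exact sub_nonneg.2 h
  have hsplit : ∑ i ∈ Finset.range (p + 1 + q), (c i - c p) * (x i - (node l r).coords.getD i 0) =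
      ∑ i ∈ Finset.range p, (c i - c p) * (x i - l.coords.getD i 0) +
        ∑ i ∈ Finset.range q,
          (c (p + 1 + i) - c p) * (x (p + 1 + i) - r.coords.getD i 0) := by
    rw [sum_range_add_one_add, sub_self, zero_mul, add_zero]
    congr 1
    · refine Finset.sum_congr rfl fun i hi => ?_
      rw [getD_coords_node_left l r (by rw [hl]; exact Finset.mem_range.1 hi)]
    · refine Finset.sum_congr rfl fun i _ => ?_
      rw [← hl, getD_coords_node_right]
  calc (0 : ℝ)
      ≤ ∑ i ∈ Finset.range (p + 1 + q), (c i - c p) * (x i - (node l r).coords.getD i 0) +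
        (c p - m) * ∑ i ∈ Finset.range (p + 1 + q), (x i - (node l r).coords.getD i 0) := by
        rw [hsplit]
        positivity
    _ = _ := by
        rw [Finset.mul_sum, ← Finset.sum_add_distrib]
        exact Finset.sum_congr rfl fun i _ => by ring

/-- A point of `ℝ^n` satisfying the inequalities of the associahedron, with the coordinates of
total sum `n (n + 1) / 2`, is in the convex hull of Loday's points. -/
theorem mem_convexHull_of_sum_interval_le (n : ℕ) (x : ℕ → ℝ)
    (hx : ∀ a k, a + k ≤ n → (k : ℝ) * (k + 1) / 2 ≤ ∑ i ∈ Finset.range k, x (a + i))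
    (hsum : ∑ i ∈ Finset.range n, x i = (n : ℝ) * (n + 1) / 2) :
    (fun i : Fin n => x i) ∈
      convexHull ℝ {y : Fin n → ℝ | ∃ t : PBT, t.coords.length = n ∧ y = M n t} := by
  by_contra hmem
  have hfin : {y : Fin n → ℝ | ∃ t : PBT, t.coords.length = n ∧ y = M n t}.Finite := by
    refine ((finite_setOf_length_coords_lt (n + 1)).image (M n)).subset ?_
    rintro _ ⟨t, ht, rfl⟩
    exact ⟨t, ht.trans_lt n.lt_succ_self, rfl⟩
  obtain ⟨f, u, hfx, hft⟩ := geometric_hahn_banach_point_closed (convex_convexHull ℝ _)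
    (hfin.isClosed_convexHull (𝕜 := ℝ)) hmem
  let c : ℕ → ℝ := fun i => if h : i < n then f (Pi.single ⟨i, h⟩ 1) else 0
  have hf (y : ℕ → ℝ) : f (fun i : Fin n => y i) = ∑ i ∈ Finset.range n, c i * y i := by
    rw [Finset.sum_range, ← ContinuousLinearMap.coe_coe, LinearMap.pi_apply_eq_sum_univ]
    refine Finset.sum_congr rfl fun i _ => ?_
    simp only [c, i.isLt, dif_pos, smul_eq_mul, mul_comm (y i)]
    rw [show (fun j => if i = j then (1 : ℝ) else 0) = Pi.single i 1 from ?_]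
    · rfl
    ext j
    simp [Pi.single_apply, eq_comm]
  obtain ⟨t, ht, htc⟩ := exists_sum_sub_mul_sub_nonneg n c x hx
  obtain ⟨m, hm⟩ : ∃ m, ∀ i < n, m ≤ c i := by
    obtain ⟨m, hm⟩ := ((Finset.range n).image c).bddBelow
    exact ⟨m, fun i hi => hm (by simpa using ⟨i, hi, rfl⟩)⟩
  have h := htc m hm
  have hM := sum_range_getD_coords t
  rw [ht] at hM
  have heq : ∑ i ∈ Finset.range n, (c i - m) * (x i - t.coords.getD i 0) =
      f (fun i : Fin n => x i) - f (M n t) := by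
    have hfM : f (M n t) = ∑ i ∈ Finset.range n, c i * t.coords.getD i 0 :=
      hf fun i => t.coords.getD i 0
    rw [hf, hfM]
    simp only [sub_mul, mul_sub, Finset.sum_sub_distrib, ← Finset.mul_sum, hsum, hM]
    ring
  have hu := hft (M n t) (subset_convexHull ℝ _ ⟨t, ht, rfl⟩)
  linarith

end PBT

theorem sum_range_cast_add_one (n : ℕ) :
    ∑ i ∈ Finset.range n, ((i : ℝ) + 1) = (n : ℝ) * (n + 1) / 2 := by
  induction n with
  | zero => simp
  | succ n ih =>
    rw [Finset.sum_range_succ, ih]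
    push_cast
    ring

theorem le_sum_of_injOn_of_pos (k : ℕ) (g : ℕ → ℕ) (hg : Set.InjOn g (Finset.range k))
    (hpos : ∀ i < k, 1 ≤ g i) :
    (k : ℝ) * (k + 1) / 2 ≤ ∑ i ∈ Finset.range k, (g i : ℝ) := by
  have hinj : Set.InjOn (fun i => (g i : ℤ)) (Finset.range k) :=
    fun i hi j hj h => hg hi hj (Int.ofNat.inj h)
  have h := Finset.sum_range_le_sum (s := (Finset.range k).image fun i => (g i : ℤ)) (c := 1)
    (by
      simp only [Finset.forall_mem_image, Finset.mem_range]
      exact fun i hi => Int.ofNat_le.2 (hpos i hi))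
  rw [Finset.card_image_of_injOn hinj, Finset.card_range, Finset.sum_image hinj] at h
  rw [← sum_range_cast_add_one]
  simp only [add_comm (1 : ℤ)] at h
  exact_mod_cast h

/-- The Stasheff polytope contains the permutohedron: every permutohedron vertex
`M(σ)` lies in the convex hull of `{M(t) : t ∈ Y n}`; consequently the convex hull of
`{M(σ) : σ ∈ S_n}` is contained in the convex hull of `{M(t) : t ∈ Y n}`. -/
theorem stmt6 (n : ℕ) :
    (∀ σ : Equiv.Perm (Fin n),
      Mperm n σ ∈
        convexHull ℝ {x : Fin n → ℝ | ∃ t : PBT, t.coords.length = n ∧ x = PBT.M n t}) ∧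
    convexHull ℝ {x : Fin n → ℝ | ∃ σ : Equiv.Perm (Fin n), x = Mperm n σ} ⊆
      convexHull ℝ {x : Fin n → ℝ | ∃ t : PBT, t.coords.length = n ∧ x = PBT.M n t} := by
  have hmem (σ : Equiv.Perm (Fin n)) : Mperm n σ ∈
      convexHull ℝ {x : Fin n → ℝ | ∃ t : PBT, t.coords.length = n ∧ x = PBT.M n t} := by
    let g : ℕ → ℕ := fun i => if h : i < n then (σ ⟨i, h⟩ : ℕ) + 1 else 0
    have hg (i : Fin n) : g i = (σ i : ℕ) + 1 := dif_pos i.isLt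
    have hgσ : Mperm n σ = fun i : Fin n => (g i : ℝ) := by
      ext i
      rw [hg, Mperm]
      push_cast
      rfl
    rw [hgσ]
    refine PBT.mem_convexHull_of_sum_interval_le n (fun i => (g i : ℝ)) (fun a k hak => ?_) ?_
    · refine le_sum_of_injOn_of_pos k (fun i => g (a + i)) (fun i hi j hj hij => ?_) fun i hi => ?_
      · have hi' : a + i < n := by have := Finset.mem_range.1 hi; omega
        have hj' : a + j < n := by have := Finset.mem_range.1 hj; omega
        have hσ := ((hg ⟨a + i, hi'⟩).symm.trans hij).trans (hg ⟨a + j, hj'⟩)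
        have := congrArg Fin.val (σ.injective (Fin.ext (Nat.succ_injective hσ)))
        exact Nat.add_left_cancel this
      · have := hg ⟨a + i, by omega⟩
        simp only at this ⊢
        omega
    · rw [Finset.sum_range, ← sum_range_cast_add_one, Finset.sum_range,
        ← Equiv.sum_comp σ fun i : Fin n => ((i : ℕ) : ℝ) + 1]
      exact Finset.sum_congr rfl fun i _ => by rw [hg]; push_cast; rfl
  refine ⟨hmem, convexHull_min ?_ (convex_convexHull ℝ _)⟩
  rintro _ ⟨σ, rfl⟩
  exact hmem σ
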